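/- arXiv:1007.1602 — 9 statements merged into one kernel-verified Lean document; each statement's English description precedes it below -/
import Mathlib

section
/- Let n ≥ 2 and let x_0, x_1, ..., x_n be positive real numbers. Let A be the (n+1)×(n+1) real matrix whose (i,j) entry is 2·x_i·x_j for i ≠ j and −2·x_i² for i = j (indices 0 ≤ i, j ≤ n). Then det A = (−1)^n · (n−1) · 2^{2n+1} · (∏_{i=0}^{n} x_i)². -/
theorem det_A_formula (n : ℕ) (hn : 2 ≤ n) (x : Fin (n + 1) → ℝ)
    (hx : ∀ i, 0 < x i)
    (A : Matrix (Fin (n + 1)) (Fin (n + 1)) ℝ)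
    (hA : A = Matrix.of fun i j =>
      if i = j then -2 * x i ^ 2 else 2 * x i * x j) :
    A.det = (-1 : ℝ) ^ n * ((n : ℝ) - 1) * 2 ^ (2 * n + 1) * (∏ i, x i) ^ 2 := by
  have factorization : A = Matrix.diagonal (fun i => -4 * x i) *
      (1 + Matrix.replicateCol Unit (fun _ => (-1 / 2 : ℝ)) *
        Matrix.replicateRow Unit (fun _ => (1 : ℝ))) * Matrix.diagonal x := by
    rw [hA]
    ext i j
    rw [Matrix.mul_diagonal, Matrix.diagonal_mul]
    by_cases h : i = j
    · subst h
      simp [Matrix.mul_apply]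
      ring
    · simp [Matrix.mul_apply, h]
      ring
  rw [factorization, Matrix.det_mul, Matrix.det_mul, Matrix.det_diagonal, Matrix.det_diagonal,
    Matrix.det_one_add_replicateCol_mul_replicateRow, Finset.prod_mul_distrib]
  have hpow : (-4 : ℝ) ^ n = (-1) ^ n * 2 ^ (n * 2) := by
    rw [mul_comm n 2, pow_mul, ← mul_pow]
    norm_num
  simp [dotProduct]
  ring_nf
  rw [hpow]
  ring
end

section
/- Let n ≥ 2 and let x_0, x_1, ..., x_n be positive real numbers. Let A be the (n+1)×(n+1) real matrix whose (i,j) entry is 2·x_i·x_j for i ≠ j and −2·x_i² for i = j. Then A is invertible and its inverse is the (n+1)×(n+1) matrix whose (i,j) entry equals (2−n)/(4(n−1)) · 1/x_i² when i = j, and 1/(4(n−1)) · 1/(x_i·x_j) when i ≠ j. -/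
theorem inv_A_formula (n : ℕ) (hn : 2 ≤ n) (x : Fin (n + 1) → ℝ)
    (hx : ∀ i, 0 < x i)
    (A : Matrix (Fin (n + 1)) (Fin (n + 1)) ℝ)
    (hA : A = Matrix.of fun i j =>
      if i = j then -2 * x i ^ 2 else 2 * x i * x j) :
    IsUnit A.det ∧
      A⁻¹ = Matrix.of fun i j =>
        if i = j then (2 - (n : ℝ)) / (4 * ((n : ℝ) - 1)) * (1 / x i ^ 2)
        else 1 / (4 * ((n : ℝ) - 1)) * (1 / (x i * x j)) := by
  have hn' : (n : ℝ) - 1 ≠ 0 := by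
    have : (2 : ℝ) ≤ n := by exact_mod_cast hn
    linarith
  have hx' : ∀ i, x i ≠ 0 := fun i => (hx i).ne'
  suffices h : A * (Matrix.of fun i j =>
      if i = j then (2 - (n : ℝ)) / (4 * ((n : ℝ) - 1)) * (1 / x i ^ 2)
      else 1 / (4 * ((n : ℝ) - 1)) * (1 / (x i * x j))) = 1 from
    ⟨Matrix.isUnit_det_of_right_inverse h, Matrix.inv_eq_right_inv h⟩
  subst hA
  ext i j
  rw [Matrix.mul_apply]
  have term : ∀ k, (if i = k then -2 * x i ^ 2 else 2 * x i * x k) *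
      (if k = j then (2 - (n : ℝ)) / (4 * ((n : ℝ) - 1)) * (1 / x k ^ 2)
        else 1 / (4 * ((n : ℝ) - 1)) * (1 / (x k * x j))) =
      x i / x j * (1 / (2 * ((n : ℝ) - 1)) - (if i = k then 1 / ((n : ℝ) - 1) else 0)
        - (if k = j then 1 / 2 else 0) + (if i = k then (if i = j then 1 else 0) else 0)) := by
    intro k
    have hi := hx' i
    have hj := hx' j
    have hk := hx' k
    by_cases hik : i = k
    · subst hik
      by_cases hij : i = j
      · subst hij
        simp only [if_true]
        field_simp
        ring
      · simp only [if_true, if_neg hij]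
        field_simp
        ring
    · by_cases hkj : k = j
      · subst hkj
        simp only [if_true, if_neg hik]
        field_simp
        ring
      · simp only [if_neg hik, if_neg hkj]
        field_simp
        ring
  simp only [Matrix.of_apply, term]
  rw [← Finset.mul_sum, Finset.sum_add_distrib, Finset.sum_sub_distrib, Finset.sum_sub_distrib]
  simp only [Finset.sum_const, Finset.card_univ, Fintype.card_fin, nsmul_eq_mul,
    Finset.sum_ite_eq, Finset.sum_ite_eq', Finset.mem_univ, if_true, Matrix.one_apply]
  have hj := hx' j
  split_ifs with hij
  · subst hij
    push_cast
    field_simp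
    ring
  · push_cast
    field_simp
    ring
end

section
/- Let n ≥ 2 and let x_0, x_1, ..., x_n be positive real numbers. Let D be the (n+1)×(n+1) real matrix whose (i,j) entry is (x_i + x_j)² for i ≠ j and 0 for i = j. Then det D = (−1)^n · (2^{2n−3}/(n−1)) · (∏_{i=0}^{n} x_i)² · ([M·P − (n−1)(n−3)]² − [M² − (n−1)·N]·[P² − (n−1)·Q]), where M = Σ_{i=0}^{n} x_i, N = Σ_{i=0}^{n} x_i², P = Σ_{i=0}^{n} 1/x_i, and Q = Σ_{i=0}^{n} 1/x_i². -/
theorem det_D_formula (n : ℕ) (hn : 2 ≤ n) (x : Fin (n + 1) → ℝ)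
    (hx : ∀ i, 0 < x i)
    (D : Matrix (Fin (n + 1)) (Fin (n + 1)) ℝ)
    (hD : D = Matrix.of fun i j =>
      if i = j then 0 else (x i + x j) ^ 2)
    (M N P Q : ℝ)
    (hM : M = ∑ i, x i) (hN : N = ∑ i, x i ^ 2)
    (hP : P = ∑ i, 1 / x i) (hQ : Q = ∑ i, 1 / x i ^ 2) :
    D.det = (-1 : ℝ) ^ n * ((2 : ℝ) ^ (2 * n - 3) / ((n : ℝ) - 1)) * (∏ i, x i) ^ 2 *
      ((M * P - ((n : ℝ) - 1) * ((n : ℝ) - 3)) ^ 2 -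
        (M ^ 2 - ((n : ℝ) - 1) * N) * (P ^ 2 - ((n : ℝ) - 1) * Q)) := by
  obtain ⟨k, rfl⟩ := Nat.exists_eq_add_of_le' hn
  set U : Matrix (Fin (k + 2 + 1)) (Fin 3) ℝ := Matrix.of fun i => ![x i, 1, 1 / x i] with hU
  set V : Matrix (Fin 3) (Fin (k + 2 + 1)) ℝ :=
    Matrix.of ![fun j => -(1 / x j) / 4, fun _ => -2 / 4, fun j => -x j / 4] with hV
  have hfac : D = Matrix.diagonal (fun i => -4 * x i) * (1 + U * V) * Matrix.diagonal x := by
    subst hD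
    ext i j
    have hi := (hx i).ne'
    have hj := (hx j).ne'
    rw [Matrix.mul_diagonal, Matrix.diagonal_mul]
    by_cases h : i = j
    · subst h
      simp [hU, hV, Matrix.mul_apply, Fin.sum_univ_three]
      field_simp
      norm_num
    · simp [hU, hV, Matrix.mul_apply, Fin.sum_univ_three, h]
      field_simp
      ring
  have hUV : V * U = !![-((k : ℝ) + 3) / 4, -P / 4, -Q / 4;
      -M / 2, -((k : ℝ) + 3) / 2, -P / 2;
      -N / 4, -M / 4, -((k : ℝ) + 3) / 4] := by
    subst hM hN hP hQ
    have hsum : (k : ℝ) + 3 = ∑ _i : Fin (k + 2 + 1), (1 : ℝ) := by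
      simp; ring
    rw [hsum]
    ext a b
    fin_cases a <;> fin_cases b <;>
      simp only [hU, hV, Matrix.mul_apply, Matrix.of_apply, Matrix.cons_val', Matrix.cons_val,
        Fin.mk_one, Fin.zero_eta, Fin.reduceFinMk, Fin.isValue, ← Finset.sum_neg_distrib,
        Finset.sum_div] <;>
      refine Finset.sum_congr rfl fun i _ => ?_ <;>
      have hi := (hx i).ne' <;>
      field_simp <;> norm_num
  rw [hfac, Matrix.det_mul, Matrix.det_mul, Matrix.det_diagonal, Matrix.det_diagonal,
    Matrix.det_one_add_mul_comm, hUV, Finset.prod_mul_distrib, Matrix.det_fin_three]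
  simp only [Finset.prod_const, Finset.card_univ, Fintype.card_fin, Matrix.add_apply]
  have hk : (0 : ℝ) < ((k + 2 : ℕ) : ℝ) - 1 := by
    push_cast
    have : (0 : ℝ) ≤ k := k.cast_nonneg
    linarith
  have h4 : (-4 : ℝ) ^ (k + 2 + 1) = -64 * ((-1) ^ k * 2 ^ (2 * k)) := by
    rw [pow_mul, ← mul_pow, pow_add, pow_add]
    norm_num
    ring
  have h2 : (2 : ℝ) ^ (2 * (k + 2) - 3) = 2 * 2 ^ (2 * k) := by
    rw [show 2 * (k + 2) - 3 = 2 * k + 1 by omega, pow_succ, mul_comm]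
  rw [h4, h2]
  simp
  replace hk := hk.ne'
  push_cast at hk
  field_simp
  ring
end

section
/- Let n ≥ 2 and let x_0, x_1, ..., x_n be positive real numbers. Let A be the (n+1)×(n+1) matrix with diagonal entries −2·x_i² and off-diagonal entries 2·x_i·x_j, let B₁ be the (n+1)×2 matrix whose i-th row is (x_i², 1), let B₂ be the 2×(n+1) matrix whose columns are (1, x_i²)ᵀ, and let E₂ be the 2×2 identity matrix. Then E₂ + B₂·A⁻¹·B₁ equals the 2×2 matrix (1/(4(n−1))) · [[X₁, X₂], [X₃, X₁]], where X₁ = M·P − (n−1)(n−3), X₂ = P² − (n−1)·Q, X₃ = M² − (n−1)·N, with M = Σ_{i=0}^{n} x_i, N = Σ_{i=0}^{n} x_i², P = Σ_{i=0}^{n} 1/x_i, Q = Σ_{i=0}^{n} 1/x_i². -/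
/-- The inverse of the matrix with diagonal entries `-2 * x i ^ 2` and off-diagonal entries
`2 * x i * x j`, as a rank-one perturbation of a diagonal matrix. -/
lemma inv_of_ite_neg_two_mul_sq (n : ℕ) (hn : (n : ℝ) - 1 ≠ 0) (x : Fin (n + 1) → ℝ)
    (hx : ∀ i, x i ≠ 0) :
    (Matrix.of fun i j => if i = j then -2 * x i ^ 2 else 2 * x i * x j)⁻¹ =
      Matrix.of fun i j => 1 / (4 * ((n : ℝ) - 1)) * (1 / x i) * (1 / x j) -
        if i = j then 1 / 4 * (1 / x i ^ 2) else 0 := by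
  refine Matrix.inv_eq_right_inv ?_
  ext i k
  have entry : ∀ j, (if i = j then -2 * x i ^ 2 else 2 * x i * x j) *
      (1 / (4 * ((n : ℝ) - 1)) * (1 / x j) * (1 / x k) -
        if j = k then 1 / 4 * (1 / x j ^ 2) else 0) =
      1 / (2 * ((n : ℝ) - 1)) * (x i / x k) - (if j = k then x i / x k / 2 else 0) -
        (if i = j then 1 / ((n : ℝ) - 1) * (x i / x k) - (if i = k then 1 else 0) else 0) := by
    intro j
    have hi := hx i
    have hj := hx j
    have hk := hx k
    split_ifs <;> subst_vars <;> first | contradiction | (field_simp; ring)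
  simp only [Matrix.mul_apply, Matrix.of_apply, entry, Finset.sum_sub_distrib, Finset.sum_const,
    Finset.card_univ, Fintype.card_fin, nsmul_eq_mul, Finset.sum_ite_eq, Finset.sum_ite_eq',
    Finset.mem_univ, if_true, Matrix.one_apply]
  have hk := hx k
  split_ifs <;> push_cast <;> field_simp <;> ring

/-- The bilinear form of a rank-one perturbation of a diagonal matrix. -/
lemma sum_sum_mul_rank_one_sub_diagonal {ι R : Type*} [Fintype ι] [DecidableEq ι] [CommRing R]
    (a : R) (u d p q : ι → R) :
    ∑ j, (∑ i, p i * (a * u i * u j - if i = j then d i else 0)) * q j =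
      a * (∑ i, p i * u i) * (∑ j, u j * q j) - ∑ j, p j * d j * q j := by
  simp only [mul_sub, mul_ite, mul_zero, Finset.sum_sub_distrib, Finset.sum_ite_eq',
    Finset.mem_univ, if_true, sub_mul, Finset.mul_sum, Finset.sum_mul]
  congr 1
  exact Finset.sum_congr rfl fun j _ => Finset.sum_congr rfl fun i _ => by ring

theorem schur_complement_formula (n : ℕ) (hn : 2 ≤ n) (x : Fin (n + 1) → ℝ)
    (hx : ∀ i, 0 < x i)
    (A : Matrix (Fin (n + 1)) (Fin (n + 1)) ℝ)
    (hA : A = Matrix.of fun i j =>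
      if i = j then -2 * x i ^ 2 else 2 * x i * x j)
    (B₁ : Matrix (Fin (n + 1)) (Fin 2) ℝ)
    (hB₁ : B₁ = Matrix.of fun i j => if j = 0 then x i ^ 2 else 1)
    (B₂ : Matrix (Fin 2) (Fin (n + 1)) ℝ)
    (hB₂ : B₂ = Matrix.of fun i j => if i = 0 then 1 else x j ^ 2)
    (M N P Q : ℝ)
    (hM : M = ∑ i, x i) (hN : N = ∑ i, x i ^ 2)
    (hP : P = ∑ i, 1 / x i) (hQ : Q = ∑ i, 1 / x i ^ 2) :
    (1 : Matrix (Fin 2) (Fin 2) ℝ) + B₂ * A⁻¹ * B₁ =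
      (1 / (4 * ((n : ℝ) - 1))) •
        !![M * P - ((n : ℝ) - 1) * ((n : ℝ) - 3), P ^ 2 - ((n : ℝ) - 1) * Q;
           M ^ 2 - ((n : ℝ) - 1) * N, M * P - ((n : ℝ) - 1) * ((n : ℝ) - 3)] := by
  have hn' : (n : ℝ) - 1 ≠ 0 := by
    have : (2 : ℝ) ≤ n := by exact_mod_cast hn
    linarith
  have hx' : ∀ i, x i ≠ 0 := fun i => (hx i).ne'
  have hsq : ∀ i, x i ^ 2 * (1 / x i) = x i := fun i => by field_simp [hx' i]
  have hsq' : ∀ i, 1 / x i * x i ^ 2 = x i := fun i => by field_simp [hx' i]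
  have hdiag : ∀ i, 1 / 4 * (1 / x i ^ 2) * x i ^ 2 = 1 / 4 := fun i => by field_simp [hx' i]
  have hdiag' : ∀ i, x i ^ 2 * (1 / 4 * (1 / x i ^ 2)) = 1 / 4 := fun i => by
    field_simp [hx' i]
  rw [hA, inv_of_ite_neg_two_mul_sq n hn' x hx', hB₁, hB₂]
  ext r s
  rw [Matrix.add_apply, Matrix.mul_apply]
  simp only [Matrix.mul_apply, Matrix.of_apply]
  rw [sum_sum_mul_rank_one_sub_diagonal _ (fun i => 1 / x i) (fun i => 1 / 4 * (1 / x i ^ 2))]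
  fin_cases r <;> fin_cases s <;>
    simp only [Fin.zero_eta, Fin.mk_one, one_ne_zero, if_true, if_false, one_mul, mul_one,
      hsq, hsq', hdiag, hdiag', ← Finset.mul_sum, ← hM, ← hN, ← hP, ← hQ, Finset.sum_const,
      Finset.card_univ, Fintype.card_fin, nsmul_eq_mul, Matrix.smul_apply, smul_eq_mul,
      Matrix.one_apply, Matrix.of_apply, Matrix.cons_val', Matrix.cons_val_zero,
      Matrix.cons_val_one, Matrix.cons_val_fin_one, zero_ne_one, zero_add] <;>
    push_cast <;> field_simp <;> ring
end

section
/- Let n ≥ 2 and let Ω = [A_0, A_1, ..., A_n] be a nondegenerate n-simplex in Euclidean n-space (its n+1 vertices are affinely independent) for which there exist positive real numbers x_0, ..., x_n with dist(A_i, A_j) = x_i + x_j for all 0 ≤ i < j ≤ n. Let R be the circumradius of Ω. Then R² = ([M·P − (n−1)(n−3)]² − [M² − (n−1)·N]·[P² − (n−1)·Q]) / (8(n−1)·[P² − (n−1)·Q]), where M = Σ_{i=0}^{n} x_i, N = Σ_{i=0}^{n} x_i², P = Σ_{i=0}^{n} 1/x_i, Q = Σ_{i=0}^{n} 1/x_i².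 -/
open scoped RealInnerProductSpace

/-- The sum of the weighted squared distances from one vertex, for pairwise distances
`x i + x j`. -/
theorem sum_mul_dist_sq_of_dist_eq_add {ι α : Type*} [Fintype ι] [PseudoMetricSpace α]
    (p : ι → α) (x : ι → ℝ) (hdist : ∀ i j, i ≠ j → dist (p i) (p j) = x i + x j)
    (w : ι → ℝ) (i : ι) :
    ∑ j, w j * dist (p i) (p j) ^ 2 =
      x i ^ 2 * ∑ j, w j + 2 * x i * ∑ j, w j * x j + ∑ j, w j * x j ^ 2
        - 4 * x i ^ 2 * w i := by
  classical
  have h : ∀ j, w j * dist (p i) (p j) ^ 2 =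
      x i ^ 2 * w j + 2 * x i * (w j * x j) + w j * x j ^ 2
        - (if i = j then 4 * x i ^ 2 * w i else 0) := by
    intro j
    by_cases hij : i = j
    · subst hij
      simp only [dist_self, if_true]
      ring
    · rw [hdist i j hij, if_neg hij]
      ring
  simp only [h, Finset.sum_sub_distrib, Finset.sum_add_distrib, ← Finset.mul_sum,
    Finset.sum_ite_eq, Finset.mem_univ, if_true]

/-- Inner products of a vector of a sphere with a weighted sum of vectors of the same sphere. -/
theorem inner_sum_smul_eq_of_norm_eq {ι V : Type*} [Fintype ι] [NormedAddCommGroup V]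
    [InnerProductSpace ℝ V] (v : ι → V) (r : ℝ) (hv : ∀ i, ‖v i‖ = r) (w : ι → ℝ) (i : ι) :
    ⟪v i, ∑ j, w j • v j⟫ = r ^ 2 * ∑ j, w j - (∑ j, w j * dist (v i) (v j) ^ 2) / 2 := by
  rw [inner_sum, Finset.mul_sum, Finset.sum_div, ← Finset.sum_sub_distrib]
  refine Finset.sum_congr rfl fun j _ => ?_
  rw [real_inner_smul_right, dist_eq_norm, norm_sub_sq_real, hv, hv]
  ring

theorem circumradius_circumscriptible (n : ℕ) (hn : 2 ≤ n)
    (Ω : Affine.Simplex ℝ (EuclideanSpace ℝ (Fin n)) n)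
    (x : Fin (n + 1) → ℝ) (hx : ∀ i, 0 < x i)
    (hdist : ∀ i j : Fin (n + 1), i < j →
      dist (Ω.points i) (Ω.points j) = x i + x j)
    (M N P Q : ℝ)
    (hM : M = ∑ i, x i) (hN : N = ∑ i, x i ^ 2)
    (hP : P = ∑ i, 1 / x i) (hQ : Q = ∑ i, 1 / x i ^ 2) :
    Ω.circumradius ^ 2 =
      ((M * P - ((n : ℝ) - 1) * ((n : ℝ) - 3)) ^ 2 -
        (M ^ 2 - ((n : ℝ) - 1) * N) * (P ^ 2 - ((n : ℝ) - 1) * Q)) /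
      (8 * ((n : ℝ) - 1) * (P ^ 2 - ((n : ℝ) - 1) * Q)) := by
  have hx0 : ∀ i, x i ≠ 0 := fun i => (hx i).ne'
  have hn1 : (0 : ℝ) < (n : ℝ) - 1 := by
    have : (2 : ℝ) ≤ n := by exact_mod_cast hn
    linarith
  have hcard : ∑ _i : Fin (n + 1), (1 : ℝ) = n + 1 := by simp
  have hQpos : 0 < Q := by
    rw [hQ]
    exact Finset.sum_pos (fun i _ => by have := hx i; positivity) Finset.univ_nonempty
  set R := Ω.circumradius
  set v : Fin (n + 1) → EuclideanSpace ℝ (Fin n) := fun i => Ω.points i - Ω.circumcenter with hv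
  have hvnorm : ∀ i, ‖v i‖ = R := fun i => by
    rw [hv, ← dist_eq_norm, Ω.dist_circumcenter_eq_circumradius]
  have hvdist : ∀ i j, i ≠ j → dist (v i) (v j) = x i + x j := by
    intro i j hij
    rw [hv, dist_sub_right]
    rcases lt_or_gt_of_ne hij with h | h
    · exact hdist i j h
    · rw [dist_comm, hdist j i h, add_comm]
  have hinner : ∀ (w : Fin (n + 1) → ℝ) i, ⟪v i, ∑ j, w j • v j⟫ =
      R ^ 2 * ∑ j, w j - (x i ^ 2 * ∑ j, w j + 2 * x i * ∑ j, w j * x j + ∑ j, w j * x j ^ 2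
        - 4 * x i ^ 2 * w i) / 2 := fun w i => by
    rw [inner_sum_smul_eq_of_norm_eq v R hvnorm, sum_mul_dist_sq_of_dist_eq_add v x hvdist]
  have hD : P ^ 2 - ((n : ℝ) - 1) * Q ≠ 0 := by
    intro hD
    let l : Fin (n + 1) → ℝ := fun i => Q * (1 / x i) - P * (1 / x i ^ 2)
    have hl0 : ∑ i, l i = 0 := by
      simp only [l, Finset.sum_sub_distrib, ← Finset.mul_sum, ← hP, ← hQ]
      ring
    have hl1 : ∑ i, l i * x i = 2 * Q := by
      have h : ∀ i, l i * x i = Q * 1 - P * (1 / x i) := fun i => by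
        have := hx0 i
        simp only [l]
        field_simp
      simp only [h, Finset.sum_sub_distrib, ← Finset.mul_sum, hcard, ← hP]
      linarith
    have hconst : ∀ i, ⟪v i, ∑ j, l j • v j⟫ = -(∑ j, l j * x j ^ 2 + 4 * P) / 2 := by
      intro i
      have h : x i ^ 2 * l i = Q * x i - P := by
        have := hx0 i
        simp only [l]
        field_simp
      rw [hinner, hl0, hl1]
      linear_combination 2 * h
    have hzero : ∑ j, l j • v j = 0 := by
      rw [← inner_self_eq_zero (𝕜 := ℝ)]
      nth_rw 1 [sum_inner]
      simp only [real_inner_smul_left, hconst, ← Finset.sum_mul, hl0, zero_mul]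
    have hl : ∀ i, l i = 0 := by
      have hzero' : ∑ j, l j • Ω.points j = 0 := by
        simpa [hv, smul_sub, Finset.sum_sub_distrib, ← Finset.sum_smul, hl0] using hzero
      exact fun i => affineIndependent_iff.1 Ω.independent Finset.univ l hl0 hzero' i
        (Finset.mem_univ i)
    simp only [hl, zero_mul, Finset.sum_const_zero] at hl1
    linarith
  obtain ⟨w, hw1, hw⟩ :=
    eq_affineCombination_of_mem_affineSpan_of_fintype Ω.circumcenter_mem_affineSpan
  have hwzero : ∑ j, w j • v j = 0 := by
    rw [Finset.affineCombination_eq_linear_combination _ _ _ hw1] at hw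
    simp only [hv, smul_sub, Finset.sum_sub_distrib, ← Finset.sum_smul, hw1, one_smul, ← hw,
      sub_self]
  set a := ∑ j, w j * x j with ha
  set b := ∑ j, w j * x j ^ 2 with hb
  have hweight : ∀ i, 4 * x i ^ 2 * w i = x i ^ 2 + 2 * a * x i + (b - 2 * R ^ 2) := by
    intro i
    have h := hinner w i
    rw [hwzero, inner_zero_right, hw1] at h
    linear_combination -2 * h
  have e0 : 4 = (n + 1 : ℝ) + 2 * a * P + (b - 2 * R ^ 2) * Q := by
    have h : ∀ i, 4 * w i = 1 + 2 * a * (1 / x i) + (b - 2 * R ^ 2) * (1 / x i ^ 2) := fun i => by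
      have := hx0 i
      field_simp
      linear_combination hweight i
    have hs := Finset.sum_congr (rfl : (Finset.univ : Finset (Fin (n + 1))) = _) fun i _ => h i
    simp only [Finset.sum_add_distrib, ← Finset.mul_sum, hcard, hw1, ← hP, ← hQ] at hs
    linarith
  have e1 : 4 * a = M + 2 * a * (n + 1) + (b - 2 * R ^ 2) * P := by
    have h : ∀ i, 4 * (w i * x i) = x i + 2 * a * 1 + (b - 2 * R ^ 2) * (1 / x i) := fun i => by
      have := hx0 i
      field_simp
      linear_combination hweight i
    have hs := Finset.sum_congr (rfl : (Finset.univ : Finset (Fin (n + 1))) = _) fun i _ => h i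
    simpa only [Finset.sum_add_distrib, ← Finset.mul_sum, hcard, ← hP, ← hM, ← ha] using hs
  have e2 : 4 * b = N + 2 * a * M + (b - 2 * R ^ 2) * (n + 1) := by
    have h : ∀ i, 4 * (w i * x i ^ 2) = x i ^ 2 + 2 * a * x i + (b - 2 * R ^ 2) * 1 := fun i => by
      linear_combination hweight i
    have hs := Finset.sum_congr (rfl : (Finset.univ : Finset (Fin (n + 1))) = _) fun i _ => h i
    simpa only [Finset.sum_add_distrib, ← Finset.mul_sum, hcard, ← hN, ← hM, ← hb] using hs
  generalize hc : b - 2 * R ^ 2 = c at e0 e1 e2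
  have hcD : c * (P ^ 2 - ((n : ℝ) - 1) * Q) = -(M * P - ((n : ℝ) - 1) * ((n : ℝ) - 3)) := by
    linear_combination ((n : ℝ) - 1) * e0 - P * e1
  have hR : 8 * ((n : ℝ) - 1) * R ^ 2 =
      -(M ^ 2 - ((n : ℝ) - 1) * N) - c * (M * P - ((n : ℝ) - 1) * ((n : ℝ) - 3)) := by
    linear_combination ((n : ℝ) - 1) * e2 - M * e1 - 4 * ((n : ℝ) - 1) * hc
  rw [eq_div_iff (by positivity)]
  linear_combination (P ^ 2 - ((n : ℝ) - 1) * Q) * hR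
    - (M * P - ((n : ℝ) - 1) * ((n : ℝ) - 3)) * hcD
end

section
/- Let n ≥ 3 and let Ω = [A_0, A_1, ..., A_n] be a nondegenerate n-simplex in Euclidean n-space for which there exist positive real numbers x_0, ..., x_n with dist(A_i, A_j) = x_i + x_j for all 0 ≤ i < j ≤ n. Let R be the circumradius of Ω, let ρ > 0 be its edge-inradius given by ρ² = 2(n−1)/((Σ_{i=0}^{n} 1/x_i)² − (n−1)·Σ_{i=0}^{n} 1/x_i²), let O be the circumcenter of Ω, and let G be the centroid of its vertices. Then R² − (2n/(n−1))·ρ² ≤ (n+1)²·dist(O, G)². -/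
/-- The barycentric weights of the circumcenter, applied to the squared distances from any vertex,
give twice the squared circumradius. -/
theorem exists_weights_sum_mul_dist_sq_circumcenter {n : ℕ}
    (Ω : Affine.Simplex ℝ (EuclideanSpace ℝ (Fin n)) n) :
    ∃ w : Fin (n + 1) → ℝ, ∑ j, w j = 1 ∧
      ∀ i, ∑ j, w j * dist (Ω.points i) (Ω.points j) ^ 2 = 2 * Ω.circumradius ^ 2 := by
  obtain ⟨w, hw, hO⟩ :=
    eq_affineCombination_of_mem_affineSpan_of_fintype Ω.circumcenter_mem_affineSpan
  refine ⟨w, hw, fun i => ?_⟩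
  rw [Finset.affineCombination_eq_linear_combination _ _ _ hw] at hO
  have hzero : ∑ j, w j • (Ω.points j - Ω.circumcenter) = 0 := by
    simp only [smul_sub, Finset.sum_sub_distrib, ← Finset.sum_smul, hw, one_smul]
    rw [← hO, sub_self]
  have hnorm : ∀ j, ‖Ω.points j - Ω.circumcenter‖ = Ω.circumradius := fun j => by
    rw [← dist_eq_norm, Ω.dist_circumcenter_eq_circumradius]
  have hterm : ∀ j, w j * dist (Ω.points i) (Ω.points j) ^ 2 = 2 * Ω.circumradius ^ 2 * w j -
      2 * inner ℝ (Ω.points i - Ω.circumcenter) (w j • (Ω.points j - Ω.circumcenter)) := by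
    intro j
    rw [dist_eq_norm, ← sub_sub_sub_cancel_right _ _ Ω.circumcenter, norm_sub_sq_real, hnorm, hnorm,
      real_inner_smul_right]
    ring
  simp_rw [hterm]
  rw [Finset.sum_sub_distrib, ← Finset.mul_sum, ← Finset.mul_sum, ← inner_sum, hzero, hw,
    inner_zero_right]
  ring

/-- The Leibniz relation between the circumcenter and the centroid of a simplex. -/
theorem sq_mul_dist_circumcenter_centroid_sq {n : ℕ}
    (Ω : Affine.Simplex ℝ (EuclideanSpace ℝ (Fin n)) n) :
    ((n : ℝ) + 1) ^ 2 * dist Ω.circumcenter (Finset.univ.centroid ℝ Ω.points) ^ 2 =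
      ((n : ℝ) + 1) ^ 2 * Ω.circumradius ^ 2 -
        (∑ i, ∑ j, dist (Ω.points i) (Ω.points j) ^ 2) / 2 := by
  have hn : (n : ℝ) + 1 ≠ 0 := by positivity
  have hnorm : ∀ j, ‖Ω.points j - Ω.circumcenter‖ = Ω.circumradius := fun j => by
    rw [← dist_eq_norm, Ω.dist_circumcenter_eq_circumradius]
  have hG : ((n : ℝ) + 1) • (Finset.univ.centroid ℝ Ω.points - Ω.circumcenter) =
      ∑ i, (Ω.points i - Ω.circumcenter) := by
    rw [Finset.centroid_def, Finset.affineCombination_eq_linear_combination _ _ _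
      (Finset.sum_centroidWeights_eq_one_of_nonempty ℝ _ Finset.univ_nonempty)]
    simp only [Finset.centroidWeights_apply, Finset.card_univ, Fintype.card_fin,
      Finset.sum_sub_distrib, Finset.sum_const, ← Finset.smul_sum, smul_sub, smul_smul]
    push_cast
    rw [mul_inv_cancel₀ hn, one_smul, ← Nat.cast_smul_eq_nsmul ℝ]
    push_cast
    rfl
  have hterm : ∀ i j, dist (Ω.points i) (Ω.points j) ^ 2 = 2 * Ω.circumradius ^ 2 -
      2 * inner ℝ (Ω.points i - Ω.circumcenter) (Ω.points j - Ω.circumcenter) := by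
    intro i j
    rw [dist_eq_norm, ← sub_sub_sub_cancel_right _ _ Ω.circumcenter, norm_sub_sq_real, hnorm, hnorm]
    ring
  have hsq : ((n : ℝ) + 1) ^ 2 * dist Ω.circumcenter (Finset.univ.centroid ℝ Ω.points) ^ 2 =
      ‖∑ i, (Ω.points i - Ω.circumcenter)‖ ^ 2 := by
    rw [← hG, norm_smul, dist_comm, dist_eq_norm, mul_pow, Real.norm_eq_abs, sq_abs]
  rw [hsq, ← real_inner_self_eq_norm_sq]
  obtain ⟨v, hv⟩ : ∃ v : Fin (n + 1) → EuclideanSpace ℝ (Fin n),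
      ∀ i, v i = Ω.points i - Ω.circumcenter := ⟨_, fun _ => rfl⟩
  simp_rw [hterm, ← hv, Finset.sum_sub_distrib, ← Finset.mul_sum, ← inner_sum, ← sum_inner]
  simp only [Finset.sum_const, Finset.card_univ, Fintype.card_fin, nsmul_eq_mul]
  push_cast
  ring

/-- The circumradius of a circumscriptible simplex in terms of its balloon radii. -/
theorem circumradius_sq_of_dist_eq_add {n : ℕ}
    (Ω : Affine.Simplex ℝ (EuclideanSpace ℝ (Fin n)) n)
    (x : Fin (n + 1) → ℝ) (hx : ∀ i, 0 < x i)
    (hd : ∀ i j, dist (Ω.points i) (Ω.points j) ^ 2 =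
      (x i + x j) ^ 2 - if i = j then 4 * x i ^ 2 else 0) :
    8 * Ω.circumradius ^ 2 * (((n : ℝ) - 1) *
        ((∑ i, 1 / x i) ^ 2 - ((n : ℝ) - 1) * ∑ i, 1 / x i ^ 2)) =
      ((∑ i, 1 / x i) ^ 2 - ((n : ℝ) - 1) * ∑ i, 1 / x i ^ 2) *
        (((n : ℝ) - 1) * ∑ i, x i ^ 2 - (∑ i, x i) ^ 2) +
      ((∑ i, 1 / x i) * (∑ i, x i) - ((n : ℝ) - 1) * ((n : ℝ) - 3)) ^ 2 := by
  obtain ⟨w, hw, h⟩ := exists_weights_sum_mul_dist_sq_circumcenter Ω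
  set r := Ω.circumradius ^ 2
  set P := ∑ j, w j * x j with hP
  set Q := ∑ j, w j * x j ^ 2 with hQ
  have hrow : ∀ i, x i ^ 2 + 2 * x i * P + Q - 4 * w i * x i ^ 2 = 2 * r := by
    intro i
    rw [← h i]
    have hterm : ∀ j, w j * dist (Ω.points i) (Ω.points j) ^ 2 =
        x i ^ 2 * w j + 2 * x i * (w j * x j) + w j * x j ^ 2 -
          if i = j then 4 * w j * x i ^ 2 else 0 := by
      intro j
      rw [hd]
      split_ifs <;> ring
    simp_rw [hterm]
    rw [Finset.sum_sub_distrib, Finset.sum_add_distrib, Finset.sum_add_distrib, ← Finset.mul_sum,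
      ← Finset.mul_sum, hw, Finset.sum_ite_eq,
      ← hP, ← hQ, if_pos (Finset.mem_univ i)]
    ring
  have h₁ : ∀ i, 4 * w i = 1 + 2 * P * (1 / x i) + (Q - 2 * r) * (1 / x i ^ 2) := by
    intro i
    have := (hx i).ne'
    field_simp
    linear_combination -hrow i
  have h₂ : ∀ i, 4 * (w i * x i) = x i + 2 * P + (Q - 2 * r) * (1 / x i) := by
    intro i
    have := (hx i).ne'
    field_simp
    linear_combination -hrow i
  have h₃ : ∀ i, 4 * (w i * x i ^ 2) = x i ^ 2 + 2 * P * x i + (Q - 2 * r) := by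
    intro i
    linear_combination -hrow i
  have e₁ := Finset.sum_congr (rfl : Finset.univ = Finset.univ) fun i _ => h₁ i
  have e₂ := Finset.sum_congr (rfl : Finset.univ = Finset.univ) fun i _ => h₂ i
  have e₃ := Finset.sum_congr (rfl : Finset.univ = Finset.univ) fun i _ => h₃ i
  simp only [Finset.sum_add_distrib, ← Finset.mul_sum, Finset.sum_const, Finset.card_univ,
    Fintype.card_fin, nsmul_eq_mul, hw, ← hP, ← hQ] at e₁ e₂ e₃
  push_cast at e₁ e₂ e₃
  set s₁ := ∑ i, 1 / x i
  set s₂ := ∑ i, 1 / x i ^ 2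
  set y₁ := ∑ i, x i
  set y₂ := ∑ i, x i ^ 2
  have hT : (Q - 2 * r) * (s₁ ^ 2 - ((n : ℝ) - 1) * s₂) =
      -(s₁ * y₁ - ((n : ℝ) - 1) * ((n : ℝ) - 3)) := by
    linear_combination ((n : ℝ) - 1) * e₁ - s₁ * e₂
  have hr : 8 * r * ((n : ℝ) - 1) = ((n : ℝ) - 1) * y₂ - y₁ ^ 2 -
      (Q - 2 * r) * (s₁ * y₁ - ((n : ℝ) - 1) * ((n : ℝ) - 3)) := by
    linear_combination ((n : ℝ) - 1) * e₃ - y₁ * e₂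
  linear_combination (s₁ ^ 2 - ((n : ℝ) - 1) * s₂) * hr -
    (s₁ * y₁ - ((n : ℝ) - 1) * ((n : ℝ) - 3)) * hT

theorem balloon_radii_inequality_of_card_eq_four {ι : Type*} [Fintype ι]
    (hι : Fintype.card ι = 4) (x : ι → ℝ) (hx : ∀ i, 0 < x i) :
    0 ≤ -16 * ((∑ i, 1 / x i) * ∑ i, x i) ^ 2 - 2 * (∑ i, 1 / x i) ^ 2 * (∑ i, x i ^ 2) +
      4 * (∑ i, 1 / x i ^ 2) * (∑ i, x i ^ 2) + 62 * (∑ i, 1 / x i ^ 2) * (∑ i, x i) ^ 2 + 192 := by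
  set s₁ := ∑ i, 1 / x i with hs₁
  set s₂ := ∑ i, 1 / x i ^ 2 with hs₂
  set y₁ := ∑ i, x i with hy₁
  set y₂ := ∑ i, x i ^ 2 with hy₂
  have hxy : ∀ i, x i ≤ y₁ := fun i =>
    Finset.single_le_sum (fun j _ => (hx j).le) (Finset.mem_univ i)
  have hcard : (∑ _i : ι, (1 : ℝ)) = 4 := by simp [hι]
  have hv : ∑ i, (1 / x i - s₁ / 4) ^ 2 = s₂ - s₁ ^ 2 / 4 := by
    have : ∀ i, (1 / x i - s₁ / 4) ^ 2 =
        1 / x i ^ 2 - s₁ / 2 * (1 / x i) + s₁ ^ 2 / 16 * 1 := fun i => by ring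
    simp_rw [this]
    rw [Finset.sum_add_distrib, Finset.sum_sub_distrib, ← Finset.mul_sum, ← Finset.mul_sum, hcard,
      ← hs₁, ← hs₂]
    ring
  have hw : ∑ i, (x i - y₁ / 4) ^ 2 = y₂ - y₁ ^ 2 / 4 := by
    have : ∀ i, (x i - y₁ / 4) ^ 2 = x i ^ 2 - y₁ / 2 * x i + y₁ ^ 2 / 16 * 1 := fun i => by ring
    simp_rw [this]
    rw [Finset.sum_add_distrib, Finset.sum_sub_distrib, ← Finset.mul_sum, ← Finset.mul_sum, hcard,
      ← hy₁, ← hy₂]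
    ring
  have hc : ∑ i, (x i - y₁ / 4) * (1 / x i - s₁ / 4) = 4 - s₁ * y₁ / 4 := by
    have : ∀ i, (x i - y₁ / 4) * (1 / x i - s₁ / 4) =
        1 - s₁ / 4 * x i - y₁ / 4 * (1 / x i) + s₁ * y₁ / 16 * 1 := fun i => by
      have := (hx i).ne'
      field_simp
      ring
    simp_rw [this]
    rw [Finset.sum_add_distrib, Finset.sum_sub_distrib, Finset.sum_sub_distrib, ← Finset.mul_sum,
      ← Finset.mul_sum, ← Finset.mul_sum, hcard, ← hy₁, ← hs₁]
    ring
  have hm : ∑ i, x i ^ 2 * (1 / x i - s₁ / 4) ^ 2 = 4 - s₁ * y₁ / 2 + s₁ ^ 2 * y₂ / 16 := by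
    have : ∀ i, x i ^ 2 * (1 / x i - s₁ / 4) ^ 2 =
        1 - s₁ / 2 * x i + s₁ ^ 2 / 16 * x i ^ 2 := fun i => by
      have := (hx i).ne'
      field_simp
      ring
    simp_rw [this]
    rw [Finset.sum_add_distrib, Finset.sum_sub_distrib, ← Finset.mul_sum, ← Finset.mul_sum, hcard,
      ← hy₁, ← hy₂]
    ring
  have hv0 : 0 ≤ s₂ - s₁ ^ 2 / 4 := hv ▸ Finset.sum_nonneg fun i _ => sq_nonneg _
  have hw0 : 0 ≤ y₂ - y₁ ^ 2 / 4 := hw ▸ Finset.sum_nonneg fun i _ => sq_nonneg _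
  have hcs := Finset.sum_mul_sq_le_sq_mul_sq Finset.univ (fun i => x i - y₁ / 4)
    (fun i => 1 / x i - s₁ / 4)
  rw [hc, hv, hw] at hcs
  have hle : 4 - s₁ * y₁ / 2 + s₁ ^ 2 * y₂ / 16 ≤ y₁ ^ 2 * (s₂ - s₁ ^ 2 / 4) := by
    rw [← hm, ← hv, Finset.mul_sum]
    refine Finset.sum_le_sum fun i _ => mul_le_mul_of_nonneg_right ?_ (sq_nonneg _)
    exact pow_le_pow_left₀ (hx i).le (hxy i) 2
  have hu : 16 ≤ s₁ * y₁ := by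
    have := Finset.sum_sq_le_sum_mul_sum_of_sq_le_mul Finset.univ (r := fun _ : ι => (1 : ℝ))
      (f := fun i => 1 / x i) (g := x) (fun i _ => (one_div_pos.2 (hx i)).le)
      (fun i _ => (hx i).le) (fun i _ => by have := (hx i).ne'; simp [this])
    rw [hcard] at this
    linarith
  set v := s₂ - s₁ ^ 2 / 4 with hvdef
  set w := y₂ - y₁ ^ 2 / 4 with hwdef
  set u := s₁ * y₁ with hudef
  have hα : s₁ ^ 2 * w ≤ 16 * (y₁ ^ 2 * v) := by
    have : s₁ ^ 2 * w = s₁ ^ 2 * y₂ - u ^ 2 / 4 := by rw [hwdef, hudef]; ring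
    nlinarith [sq_nonneg (u / 2 - 8)]
  have hβ : 0 ≤ y₁ ^ 2 * v := by positivity
  have hub : (u - 16) * u ≤ 16 * (y₁ ^ 2 * v) := by
    refine abs_le_of_sq_le_sq' ?_ (by positivity) |>.2
    calc ((u - 16) * u) ^ 2 = 16 * (4 - u / 4) ^ 2 * u ^ 2 := by ring
      _ ≤ 16 * (w * v) * u ^ 2 := by gcongr
      _ = 16 * (s₁ ^ 2 * w) * (y₁ ^ 2 * v) := by rw [hudef]; ring
      _ ≤ 16 * (16 * (y₁ ^ 2 * v)) * (y₁ ^ 2 * v) := by gcongr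
      _ = (16 * (y₁ ^ 2 * v)) ^ 2 := by ring
  have hkey : -16 * u ^ 2 - 2 * s₁ ^ 2 * y₂ + 4 * s₂ * y₂ + 62 * s₂ * y₁ ^ 2 + 192 =
      192 - 3 / 4 * u ^ 2 - s₁ ^ 2 * w + 63 * (y₁ ^ 2 * v) + 4 * (v * w) := by
    rw [hudef, hwdef, hvdef]; ring
  rw [hkey]
  have hvw : 0 ≤ v * w := mul_nonneg hv0 hw0
  nlinarith

theorem balloon_radii_inequality_of_four_le {n s₁ s₂ y₁ y₂ : ℝ} (hn : 4 ≤ n)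
    (hs : s₁ ^ 2 ≤ (n + 1) * s₂) (hy : y₁ ^ 2 ≤ (n + 1) * y₂) (hu : (n + 1) ^ 2 ≤ s₁ * y₁)
    (hD : 0 < s₁ ^ 2 - (n - 1) * s₂) :
    0 ≤ (s₁ ^ 2 - (n - 1) * s₂) * ((n - 1) * (n - 2) * (n - 4) * y₂ -
        (n ^ 2 + 10 * n - 8) * y₁ ^ 2) +
      n * (n + 2) * (s₁ * y₁ - (n - 1) * (n - 3)) ^ 2 + 32 * n * (n - 1) := by
  set D := s₁ ^ 2 - (n - 1) * s₂ with hDdef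
  set u := s₁ * y₁ with hudef
  have hDle : (n + 1) * D ≤ 2 * s₁ ^ 2 := by rw [hDdef]; nlinarith
  have hcoef : 0 ≤ (n - 1) * (n - 2) * (n - 4) :=
    mul_nonneg (mul_nonneg (by linarith) (by linarith)) (by linarith)
  have hX : -(6 * n * (3 * n - 2)) * y₁ ^ 2 ≤ (n + 1) * ((n - 1) * (n - 2) * (n - 4) * y₂ -
      (n ^ 2 + 10 * n - 8) * y₁ ^ 2) := by
    nlinarith [mul_le_mul_of_nonneg_left hy hcoef]
  have hDX : -(12 * n * (3 * n - 2)) * u ^ 2 ≤ (n + 1) ^ 2 * (D *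
      ((n - 1) * (n - 2) * (n - 4) * y₂ - (n ^ 2 + 10 * n - 8) * y₁ ^ 2)) := by
    have hc : 0 ≤ 6 * n * (3 * n - 2) * y₁ ^ 2 :=
      mul_nonneg (mul_nonneg (by linarith) (by linarith)) (sq_nonneg _)
    have h₁ := mul_le_mul_of_nonneg_left hX (show 0 ≤ (n + 1) * D by positivity)
    have h₂ := mul_le_mul_of_nonneg_left hDle hc
    have h₃ : u ^ 2 = s₁ ^ 2 * y₁ ^ 2 := by rw [hudef]; ring
    rw [h₃]
    linarith
  have hquad : 0 ≤ -(12 * (3 * n - 2)) * u ^ 2 +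
      (n + 1) ^ 2 * ((n + 2) * (u - (n - 1) * (n - 3)) ^ 2 + 32 * (n - 1)) := by
    clear_value u
    clear hudef hDX
    obtain ⟨t, rfl⟩ : ∃ t, u = t + (n + 1) ^ 2 := ⟨u - (n + 1) ^ 2, by ring⟩
    have ht : 0 ≤ t := by linarith
    obtain ⟨m, rfl⟩ : ∃ m, n = m + 4 := ⟨n - 4, by ring⟩
    have hm : 0 ≤ m := by linarith
    ring_nf
    positivity
  have hn0 : 0 ≤ n := by linarith
  have := mul_nonneg hn0 hquad
  refine nonneg_of_mul_nonneg_right (a := (n + 1) ^ 2) ?_ (by positivity)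
  linarith

theorem circumradius_edge_inradius_OG (n : ℕ) (hn : 3 ≤ n)
    (Ω : Affine.Simplex ℝ (EuclideanSpace ℝ (Fin n)) n)
    (x : Fin (n + 1) → ℝ) (hx : ∀ i, 0 < x i)
    (hdist : ∀ i j : Fin (n + 1), i < j →
      dist (Ω.points i) (Ω.points j) = x i + x j)
    (ρ : ℝ) (hρpos : 0 < ρ)
    (hρ : ρ ^ 2 = 2 * ((n : ℝ) - 1) /
      ((∑ i, 1 / x i) ^ 2 - ((n : ℝ) - 1) * ∑ i, 1 / x i ^ 2)) :
    Ω.circumradius ^ 2 - (2 * (n : ℝ) / ((n : ℝ) - 1)) * ρ ^ 2 ≤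
      ((n : ℝ) + 1) ^ 2 *
        dist Ω.circumcenter (Finset.univ.centroid ℝ Ω.points) ^ 2 := by
  have hd : ∀ i j, dist (Ω.points i) (Ω.points j) ^ 2 =
      (x i + x j) ^ 2 - if i = j then 4 * x i ^ 2 else 0 := by
    intro i j
    rcases lt_trichotomy i j with h | rfl | h
    · rw [hdist i j h, if_neg h.ne, sub_zero]
    · rw [dist_self, if_pos rfl]; ring
    · rw [dist_comm, hdist j i h, if_neg h.ne', sub_zero, add_comm]
  have hR := circumradius_sq_of_dist_eq_add Ω x hx hd
  have hsum : ∑ i, ∑ j, dist (Ω.points i) (Ω.points j) ^ 2 =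
      2 * (((n : ℝ) - 1) * ∑ i, x i ^ 2 + (∑ i, x i) ^ 2) := by
    simp_rw [hd, Finset.sum_sub_distrib, Finset.sum_ite_eq, add_sq, Finset.sum_add_distrib,
      ← Finset.mul_sum, ← Finset.sum_mul]
    simp only [Finset.mem_univ, if_true, ← Finset.mul_sum, Finset.sum_const, Finset.card_univ,
      Fintype.card_fin, nsmul_eq_mul]
    push_cast
    ring
  rw [sq_mul_dist_circumcenter_centroid_sq, hsum]
  have hn3 : (3 : ℝ) ≤ n := by exact_mod_cast hn
  have hn1 : 0 < (n : ℝ) - 1 := by linarith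
  have hD : 0 < (∑ i, 1 / x i) ^ 2 - ((n : ℝ) - 1) * ∑ i, 1 / x i ^ 2 := by
    have hpos : 0 < ρ ^ 2 := by positivity
    rw [hρ] at hpos
    exact (div_pos_iff_of_pos_left (by positivity)).1 hpos
  have hmain : 0 ≤ ((∑ i, 1 / x i) ^ 2 - ((n : ℝ) - 1) * ∑ i, 1 / x i ^ 2) *
      (((n : ℝ) - 1) * (n - 2) * (n - 4) * (∑ i, x i ^ 2) -
        ((n : ℝ) ^ 2 + 10 * n - 8) * (∑ i, x i) ^ 2) +
      (n : ℝ) * (n + 2) * ((∑ i, 1 / x i) * (∑ i, x i) - ((n : ℝ) - 1) * (n - 3)) ^ 2 +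
      32 * (n : ℝ) * (n - 1) := by
    rcases hn.eq_or_lt with rfl | h4
    · have := balloon_radii_inequality_of_card_eq_four (Fintype.card_fin 4) x hx
      push_cast
      linarith
    · have hs := sq_sum_le_card_mul_sum_sq (s := Finset.univ) (f := fun i => 1 / x i)
      have hy := sq_sum_le_card_mul_sum_sq (s := Finset.univ) (f := x)
      have hu := Finset.sum_sq_le_sum_mul_sum_of_sq_le_mul Finset.univ
        (r := fun _ : Fin (n + 1) => (1 : ℝ)) (f := fun i => 1 / x i) (g := x)
        (fun i _ => (one_div_pos.2 (hx i)).le) (fun i _ => (hx i).le)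
        (fun i _ => by have := (hx i).ne'; simp [this])
      simp only [Finset.card_univ, Fintype.card_fin, div_pow, one_pow, Finset.sum_const,
        nsmul_eq_mul, mul_one] at hs hy hu
      push_cast at hs hy hu
      exact balloon_radii_inequality_of_four_le (by exact_mod_cast h4) hs hy hu hD
  rw [hρ]
  set s₁ := ∑ i, 1 / x i
  set s₂ := ∑ i, 1 / x i ^ 2
  set y₁ := ∑ i, x i
  set y₂ := ∑ i, x i ^ 2
  set D := s₁ ^ 2 - ((n : ℝ) - 1) * s₂
  have hρ' : 2 * (n : ℝ) / ((n : ℝ) - 1) * (2 * ((n : ℝ) - 1) / D) * D = 4 * n := by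
    field_simp
    ring
  generalize 2 * (n : ℝ) / ((n : ℝ) - 1) * (2 * ((n : ℝ) - 1) / D) = z at hρ' ⊢
  rw [← sub_nonneg]
  refine nonneg_of_mul_nonneg_right (a := 8 * (((n : ℝ) - 1) * D)) ?_ (by positivity)
  linear_combination hmain - (n : ℝ) * (n + 2) * hR - 8 * ((n : ℝ) - 1) * hρ'
end

section
/- Let n ≥ 2 and let x_0, x_1, ..., x_n be positive real numbers with M = Σ_{i=0}^{n} x_i, N = Σ_{i=0}^{n} x_i², P = Σ_{i=0}^{n} 1/x_i, Q = Σ_{i=0}^{n} 1/x_i². If P² − (n−1)·Q > 0, then [M² − (n−1)·N]·[P² − (n−1)·Q] ≤ (4/(n+1)²)·M²·P². -/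
/-- By Cauchy–Schwarz, `(∑ y)² - (n - 1) ∑ y² ≤ 2 / (n + 1) * (∑ y)²` for `n + 1` reals. -/
theorem sq_sum_sub_mul_sum_sq_le (n : ℕ) (hn : 1 ≤ n) (y : Fin (n + 1) → ℝ) :
    (∑ i, y i) ^ 2 - ((n : ℝ) - 1) * ∑ i, y i ^ 2 ≤ 2 / ((n : ℝ) + 1) * (∑ i, y i) ^ 2 := by
  have hcs : (∑ i, y i) ^ 2 ≤ ((n : ℝ) + 1) * ∑ i, y i ^ 2 := by
    simpa using sq_sum_le_card_mul_sum_sq (s := Finset.univ) (f := y)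
  have hn' : (1 : ℝ) ≤ n := by exact_mod_cast hn
  rw [div_mul_eq_mul_div, le_div_iff₀ (by positivity)]
  nlinarith [mul_le_mul_of_nonneg_left hcs (sub_nonneg.mpr hn')]

theorem MN_PQ_upper_bound (n : ℕ) (hn : 2 ≤ n) (x : Fin (n + 1) → ℝ)
    (hx : ∀ i, 0 < x i)
    (M N P Q : ℝ)
    (hM : M = ∑ i, x i) (hN : N = ∑ i, x i ^ 2)
    (hP : P = ∑ i, 1 / x i) (hQ : Q = ∑ i, 1 / x i ^ 2)
    (hpos : 0 < P ^ 2 - ((n : ℝ) - 1) * Q) :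
    (M ^ 2 - ((n : ℝ) - 1) * N) * (P ^ 2 - ((n : ℝ) - 1) * Q) ≤
      4 / ((n : ℝ) + 1) ^ 2 * M ^ 2 * P ^ 2 := by
  have hMN : M ^ 2 - ((n : ℝ) - 1) * N ≤ 2 / ((n : ℝ) + 1) * M ^ 2 := by
    simpa only [hM, hN] using sq_sum_sub_mul_sum_sq_le n (by lia) x
  have hPQ : P ^ 2 - ((n : ℝ) - 1) * Q ≤ 2 / ((n : ℝ) + 1) * P ^ 2 := by
    simpa only [hP, hQ, one_div_pow] using
      sq_sum_sub_mul_sum_sq_le n (by lia) fun i => 1 / x i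
  calc
    _ ≤ (2 / ((n : ℝ) + 1) * M ^ 2) * (2 / ((n : ℝ) + 1) * P ^ 2) :=
      mul_le_mul hMN hPQ hpos.le (by positivity)
    _ = _ := by field_simp; ring
end

section
/- Let n ≥ 2 and let x_0, x_1, ..., x_n be positive real numbers with M = Σ_{i=0}^{n} x_i, N = Σ_{i=0}^{n} x_i², P = Σ_{i=0}^{n} 1/x_i, Q = Σ_{i=0}^{n} 1/x_i². If P² − (n−1)·Q > 0, then [M·P − (n−1)(n−3)]² − [M² − (n−1)·N]·[P² − (n−1)·Q] ≥ 32·n·(n−1). -/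
/-- Cauchy–Schwarz between positive reals and their reciprocals. -/
theorem card_sq_le_sum_mul_sum_one_div {ι : Type*} [Fintype ι] (x : ι → ℝ) (hx : ∀ i, 0 < x i) :
    (Fintype.card ι : ℝ) ^ 2 ≤ (∑ i, x i) * ∑ i, 1 / x i := by
  have h := Finset.sum_sq_le_sum_mul_sum_of_sq_le_mul Finset.univ (r := fun _ : ι => (1 : ℝ))
    (f := x) (g := fun i => 1 / x i) (fun i _ => (hx i).le) (fun i _ => (one_div_pos.2 (hx i)).le)
    (fun i _ => by simp [(hx i).ne'])
  simpa using h

/-- Reverse Cauchy–Schwarz inequality for the form `(∑ xᵢ)² - k ∑ xᵢ²`, when `y` is timelike. -/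
theorem reverse_cauchy_schwarz {ι : Type*} [Fintype ι] (x y : ι → ℝ) {k : ℝ} (hk : 0 ≤ k)
    (hy : 0 < (∑ i, y i) ^ 2 - k * ∑ i, y i ^ 2) :
    ((∑ i, x i) ^ 2 - k * ∑ i, x i ^ 2) * ((∑ i, y i) ^ 2 - k * ∑ i, y i ^ 2) ≤
      ((∑ i, x i) * (∑ i, y i) - k * ∑ i, x i * y i) ^ 2 := by
  have hsq : 0 ≤ ∑ i, ((∑ j, y j) * x i - (∑ j, x j) * y i) ^ 2 :=
    Finset.sum_nonneg fun i _ => sq_nonneg _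
  have hexp : ∑ i, ((∑ j, y j) * x i - (∑ j, x j) * y i) ^ 2 =
      (∑ i, y i) ^ 2 * ∑ i, x i ^ 2 - 2 * (∑ i, x i) * (∑ i, y i) * ∑ i, x i * y i +
        (∑ i, x i) ^ 2 * ∑ i, y i ^ 2 := by
    simp only [Finset.mul_sum (f := fun i => x i ^ 2), Finset.mul_sum (f := fun i => y i ^ 2),
      Finset.mul_sum (f := fun i => x i * y i), ← Finset.sum_sub_distrib, ← Finset.sum_add_distrib]
    exact Finset.sum_congr rfl fun i _ => by ring
  rw [hexp] at hsq
  have hQ : 0 ≤ ∑ i, y i ^ 2 := Finset.sum_nonneg fun i _ => sq_nonneg _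
  generalize (∑ i, x i) = M, (∑ i, y i) = P, (∑ i, x i ^ 2) = N, (∑ i, y i ^ 2) = Q,
    (∑ i, x i * y i) = S at *
  have hP : 0 < P ^ 2 := by nlinarith [mul_nonneg hk hQ]
  refine le_of_mul_le_mul_left ?_ hP
  nlinarith [mul_nonneg (mul_nonneg hk hsq) hy.le,
    sq_nonneg (P * (M * P - k * S) - M * (P ^ 2 - k * Q))]


theorem key_lower_bound (n : ℕ) (hn : 2 ≤ n) (x : Fin (n + 1) → ℝ)
    (hx : ∀ i, 0 < x i)
    (M N P Q : ℝ)
    (hM : M = ∑ i, x i) (hN : N = ∑ i, x i ^ 2)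
    (hP : P = ∑ i, 1 / x i) (hQ : Q = ∑ i, 1 / x i ^ 2)
    (hpos : 0 < P ^ 2 - ((n : ℝ) - 1) * Q) :
    (M * P - ((n : ℝ) - 1) * ((n : ℝ) - 3)) ^ 2 -
        (M ^ 2 - ((n : ℝ) - 1) * N) * (P ^ 2 - ((n : ℝ) - 1) * Q) ≥
      32 * (n : ℝ) * ((n : ℝ) - 1) := by
  have hn' : (2 : ℝ) ≤ n := by exact_mod_cast hn
  have hMP : ((n : ℝ) + 1) ^ 2 ≤ M * P := by
    simpa [hM, hP] using card_sq_le_sum_mul_sum_one_div x hx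
  have hS : ∑ i, x i * (1 / x i) = (n : ℝ) + 1 := by
    simp [fun i => mul_inv_cancel₀ (hx i).ne']
  have hQ' : Q = ∑ i, (1 / x i) ^ 2 := by simp [hQ]
  have hrev := reverse_cauchy_schwarz x (fun i => 1 / x i) (k := (n : ℝ) - 1) (by linarith)
    (by rwa [← hP, ← hQ'])
  rw [hS, ← hM, ← hN, ← hP, ← hQ'] at hrev
  nlinarith [mul_le_mul_of_nonneg_left hMP (by linarith : (0 : ℝ) ≤ n - 1)]
end

section
/- Let n ≥ 4 be an integer and let x_0, x_1, ..., x_n be positive real numbers with M = Σ_{i=0}^{n} x_i, N = Σ_{i=0}^{n} x_i², P = Σ_{i=0}^{n} 1/x_i, Q = Σ_{i=0}^{n} 1/x_i². If P² − (n−1)·Q > 0, then n(n+2)·[M·P − (n−1)(n−3)]² + 32·n·(n−1) ≥ [(n² + 10n − 8)·M² − (n−1)(n−2)(n−4)·N]·[P² − (n−1)·Q]. -/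
theorem key_inequality_n_ge_four (n : ℕ) (hn : 4 ≤ n) (x : Fin (n + 1) → ℝ)
    (hx : ∀ i, 0 < x i)
    (M N P Q : ℝ)
    (hM : M = ∑ i, x i) (hN : N = ∑ i, x i ^ 2)
    (hP : P = ∑ i, 1 / x i) (hQ : Q = ∑ i, 1 / x i ^ 2)
    (hpos : 0 < P ^ 2 - ((n : ℝ) - 1) * Q) :
    (n : ℝ) * ((n : ℝ) + 2) * (M * P - ((n : ℝ) - 1) * ((n : ℝ) - 3)) ^ 2 +
        32 * (n : ℝ) * ((n : ℝ) - 1) ≥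
      (((n : ℝ) ^ 2 + 10 * (n : ℝ) - 8) * M ^ 2 -
          ((n : ℝ) - 1) * ((n : ℝ) - 2) * ((n : ℝ) - 4) * N) *
        (P ^ 2 - ((n : ℝ) - 1) * Q) := by
  have hMN : M ^ 2 ≤ ((n : ℝ) + 1) * N := by
    simpa [hM, hN] using sq_sum_le_card_mul_sum_sq (s := Finset.univ) (f := x)
  have hPQ : P ^ 2 ≤ ((n : ℝ) + 1) * Q := by
    simpa [hP, hQ] using sq_sum_le_card_mul_sum_sq (s := Finset.univ) (f := fun i => 1 / x i)
  have hMP : ((n : ℝ) + 1) ^ 2 ≤ M * P := by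
    have h := Finset.sum_sq_le_sum_mul_sum_of_sq_le_mul Finset.univ
      (r := fun _ => (1 : ℝ)) (f := x) (g := fun i => 1 / x i)
      (fun i _ => (hx i).le) (fun i _ => (one_div_pos.2 (hx i)).le)
      (fun i _ => by simp [(hx i).ne'])
    simpa [hM, hP] using h
  clear hM hN hP hQ hx
  have hn' : (4 : ℝ) ≤ n := by exact_mod_cast hn
  generalize (n : ℝ) = k at *
  set A := (k ^ 2 + 10 * k - 8) * M ^ 2 - (k - 1) * (k - 2) * (k - 4) * N with hA
  set B := P ^ 2 - (k - 1) * Q with hB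
  obtain ⟨m, hm, rfl⟩ : ∃ m, 0 ≤ m ∧ k = m + 4 := ⟨k - 4, by linarith, by ring⟩
  rcases le_or_gt A 0 with hA0 | hA0
  · have hAB : A * B ≤ 0 := mul_nonpos_of_nonpos_of_nonneg hA0 hpos.le
    have hL : 0 ≤ (m + 4) * (m + 4 + 2) * (M * P - (m + 4 - 1) * (m + 4 - 3)) ^ 2 +
        32 * (m + 4) * (m + 4 - 1) := by
      have : 0 ≤ m + 4 - 1 := by linarith
      positivity
    linarith
  have hA_le : (m + 5) * A ≤ 6 * (m + 4) * (3 * m + 10) * M ^ 2 := by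
    have h := mul_le_mul_of_nonneg_left hMN (by positivity : 0 ≤ (m + 3) * (m + 2) * m)
    rw [hA]
    linear_combination h
  have hB_le : (m + 5) * B ≤ 2 * P ^ 2 := by
    have h := mul_le_mul_of_nonneg_left hPQ (by positivity : 0 ≤ m + 3)
    rw [hB]
    linear_combination h
  have hAB := mul_le_mul hA_le hB_le (by positivity) (by positivity)
  obtain ⟨d, hd, hs⟩ : ∃ d, 0 ≤ d ∧ M * P = (m + 4 + 1) ^ 2 + d :=
    ⟨M * P - (m + 4 + 1) ^ 2, by linarith, by ring⟩
  have hs2 : M ^ 2 * P ^ 2 = ((m + 5) ^ 2 + d) ^ 2 := by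
    rw [← mul_pow, hs]
    ring
  have h_gap : 0 ≤ (m + 4) * (m ^ 3 + 16 * m ^ 2 + 49 * m + 30) * d ^ 2 +
      4 * (m + 4) * (m + 5) ^ 2 * (3 * m + 2) * (m + 3) * d := by positivity
  rw [hs]
  refine le_of_mul_le_mul_left ?_ (by positivity : 0 < (m + 5) ^ 2)
  linear_combination hAB + h_gap + 12 * (m + 4) * (3 * m + 10) * hs2
end
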